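/- (Christoffel–Darboux formula for Λ^m.) For every integer l_B ≥ L and every real ν with |ν| > 1, Λ^m(ν) = √((l_B+1)² − m²) · [ q_{l_B}^m(ν) g_{l_B+1}^m(ν) − q_{l_B+1}^m(ν) g_{l_B}^m(ν) ]. -/

import Mathlib

open MeasureTheory Filter

/-- Legendre polynomial via Rodrigues' formula. -/
noncomputable def legendreP (l : ℕ) (x : ℝ) : ℝ :=
  (1 / (2 ^ l * (Nat.factorial l : ℝ))) *
    iteratedDeriv l (fun y : ℝ => (y ^ 2 - 1) ^ l) x

/-- `p_l^m(μ) = √((l−m)!/(l+m)!) (d/dμ)^m P_l(μ)`; it vanishes for `l < m`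
(in particular the convention `p_{m−1}^m = 0` holds). -/
noncomputable def pml (m l : ℕ) (μ : ℝ) : ℝ :=
  Real.sqrt ((Nat.factorial (l - m) : ℝ) / (Nat.factorial (l + m) : ℝ)) *
    iteratedDeriv m (legendreP l) μ

/-- `q_l^m(w) = (1/2) ∫_{−1}^{1} p_l^m(μ)/(w−μ) (1−μ²)^m dμ`. -/
noncomputable def qml (m l : ℕ) (w : ℝ) : ℝ :=
  (1 / 2) * ∫ μ in (-1 : ℝ)..1, pml m l μ / (w - μ) * (1 - μ ^ 2) ^ m

/-- `h_l = 2l+1 − ϖ β_l` for `l ≤ L`, and `h_l = 2l+1` for `l > L`. -/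
noncomputable def hcoef (ϖ : ℝ) (β : ℕ → ℝ) (L l : ℕ) : ℝ :=
  if l ≤ L then 2 * l + 1 - ϖ * β l else 2 * l + 1

/-- Auxiliary recursion: `chandraAux ϖ β L m ν n = g_{m+n}^m(ν)`, built from the
initial value `g_m^m(ν) = √((2m)!)/(2^m m!)`, the convention `g_{m−1}^m = 0`, and the
three-term recurrence `ν h_l g_l^m = √((l+1)²−m²) g_{l+1}^m + √(l²−m²) g_{l−1}^m`. -/
noncomputable def chandraAux (ϖ : ℝ) (β : ℕ → ℝ) (L m : ℕ) (ν : ℝ) : ℕ → ℝ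
  | 0 => Real.sqrt (Nat.factorial (2 * m)) / (2 ^ m * Nat.factorial m)
  | 1 => ν * hcoef ϖ β L m *
      (Real.sqrt (Nat.factorial (2 * m)) / (2 ^ m * Nat.factorial m)) /
      Real.sqrt (((m : ℝ) + 1) ^ 2 - (m : ℝ) ^ 2)
  | n + 2 =>
      (ν * hcoef ϖ β L (m + n + 1) * chandraAux ϖ β L m ν (n + 1) -
          Real.sqrt (((m + n + 1 : ℕ) : ℝ) ^ 2 - (m : ℝ) ^ 2) * chandraAux ϖ β L m ν n) /
        Real.sqrt (((m + n + 2 : ℕ) : ℝ) ^ 2 - (m : ℝ) ^ 2)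

/-- The normalized Chandrasekhar polynomial `g_l^m(ν)` (with value `0` for `l < m`). -/
noncomputable def gml (ϖ : ℝ) (β : ℕ → ℝ) (L m l : ℕ) (ν : ℝ) : ℝ :=
  if l < m then 0 else chandraAux ϖ β L m ν (l - m)

/-- `g^m(ν,μ) = Σ_{l=m}^{L} β_l p_l^m(μ) g_l^m(ν)`. -/
noncomputable def gfun (ϖ : ℝ) (β : ℕ → ℝ) (L m : ℕ) (ν μ : ℝ) : ℝ :=
  ∑ l ∈ Finset.Icc m L, β l * pml m l μ * gml ϖ β L m l ν

/-- `Λ^m(w) = 1 − (ϖ w/2) ∫_{−1}^{1} g^m(w,μ)/(w−μ) (1−μ²)^m dμ`. -/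
noncomputable def Lam (ϖ : ℝ) (β : ℕ → ℝ) (L m : ℕ) (w : ℝ) : ℝ :=
  1 - ϖ * w / 2 * ∫ μ in (-1 : ℝ)..1, gfun ϖ β L m w μ / (w - μ) * (1 - μ ^ 2) ^ m

/-- The off-diagonal entry `b_l = √((l²−m²)/(h_l h_{l−1}))`. -/
noncomputable def bcoef (ϖ : ℝ) (β : ℕ → ℝ) (L m l : ℕ) : ℝ :=
  Real.sqrt (((l : ℝ) ^ 2 - (m : ℝ) ^ 2) / (hcoef ϖ β L l * hcoef ϖ β L (l - 1)))

/-- The symmetric tridiagonal matrix `B(m)` with rows/columns indexed by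
`l ∈ {m, …, l_B}` (here `l = m + i` for `i : Fin (l_B − m + 1)`), zero diagonal and
off-diagonal entries `B(m)_{l,l−1} = B(m)_{l−1,l} = b_l`. -/
noncomputable def Bmat (ϖ : ℝ) (β : ℕ → ℝ) (L m lB : ℕ) :
    Matrix (Fin (lB - m + 1)) (Fin (lB - m + 1)) ℝ :=
  fun i j =>
    if (i : ℕ) + 1 = (j : ℕ) then bcoef ϖ β L m (m + j)
    else if (j : ℕ) + 1 = (i : ℕ) then bcoef ϖ β L m (m + i)
    else 0


open Polynomial in
/-- Differentiating a polynomial function iteratively is the same as evaluating the iterated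
formal derivative. -/
theorem iteratedDeriv_polynomial_eval (p : ℝ[X]) (n : ℕ) :
    iteratedDeriv n (fun x => p.eval x) = fun x => (derivative^[n] p).eval x := by
  induction n with
  | zero => simp
  | succ n ih =>
    ext x
    rw [iteratedDeriv_succ, ih, Polynomial.deriv, Function.iterate_succ_apply']

open Polynomial in
/-- The polynomial `(d/dX)^k (X² - 1)^l`. -/
noncomputable def rodrigues (l k : ℕ) : ℝ[X] := derivative^[k] ((X ^ 2 - 1) ^ l)

open Polynomial in
theorem derivative_rodrigues (l k : ℕ) : derivative (rodrigues l k) = rodrigues l (k + 1) := by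
  rw [rodrigues, rodrigues, Function.iterate_succ_apply']

open Polynomial in
theorem derivative_X_sq_sub_one_pow_succ (l : ℕ) :
    derivative ((X ^ 2 - 1 : ℝ[X]) ^ (l + 1)) =
      C (2 * ((l : ℝ) + 1)) * ((X ^ 2 - 1) ^ l * X) := by
  rw [derivative_pow]
  simp only [derivative_sub, derivative_X_sq, derivative_one, map_mul, map_add, map_natCast,
    map_one, map_ofNat, Nat.cast_add, Nat.cast_one, Nat.add_sub_cancel]
  ring

open Polynomial in
theorem rodrigues_succ_succ (l k : ℕ) :
    rodrigues (l + 1) (k + 1) =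
      C (2 * ((l : ℝ) + 1)) * (rodrigues l k * X + (k : ℝ[X]) * rodrigues l (k - 1)) := by
  rw [rodrigues, Function.iterate_succ_apply, derivative_X_sq_sub_one_pow_succ,
    iterate_derivative_C_mul, iterate_derivative_mul_X, nsmul_eq_mul]
  rfl

open Polynomial in
theorem rodrigues_add_two_add_two (l k : ℕ) :
    rodrigues (l + 2) (k + 2) =
      C (2 * ((l : ℝ) + 2)) * (C (2 * (l : ℝ) + 3) * rodrigues (l + 1) k +
        C (2 * ((l : ℝ) + 1)) * rodrigues l k) := by
  have h : derivative (derivative ((X ^ 2 - 1 : ℝ[X]) ^ (l + 2))) =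
      C (2 * ((l : ℝ) + 2)) * (C (2 * (l : ℝ) + 3) * (X ^ 2 - 1) ^ (l + 1) +
        C (2 * ((l : ℝ) + 1)) * (X ^ 2 - 1) ^ l) := by
    rw [derivative_X_sq_sub_one_pow_succ, derivative_C_mul, derivative_mul,
      derivative_X_sq_sub_one_pow_succ]
    simp only [derivative_X, map_mul, map_add, map_natCast, map_ofNat, map_one, Nat.cast_add,
      Nat.cast_one]
    ring
  rw [rodrigues, Function.iterate_succ_apply, Function.iterate_succ_apply, h,
    iterate_derivative_C_mul, iterate_map_add, iterate_derivative_C_mul,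
    iterate_derivative_C_mul]
  rfl

/-- The differentiated Bonnet recurrence, before normalization. -/
theorem rodrigues_bonnet (l k : ℕ) (x : ℝ) :
    (2 * (l : ℝ) + 2 - k) * (rodrigues (l + 2) (k + 2)).eval x +
        2 * (l + 2) * (2 * (l + 1)) * (k + 1) * (rodrigues l k).eval x =
      2 * (l + 2) * (2 * l + 3) * x * (rodrigues (l + 1) (k + 1)).eval x := by
  have h₁ := congrArg (Polynomial.eval x) (rodrigues_succ_succ (l + 1) (k + 1))
  have h₂ := congrArg (Polynomial.eval x) (rodrigues_add_two_add_two l k)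
  simp only [Polynomial.eval_mul, Polynomial.eval_add, Polynomial.eval_C, Polynomial.eval_X,
    Polynomial.eval_natCast, Polynomial.eval_one, Nat.add_sub_cancel, Nat.cast_add, Nat.cast_one, add_assoc,
    one_add_one_eq_two] at h₁ h₂
  linear_combination (2 * (l : ℝ) + 3) * h₁ - (k + 1) * h₂

open Polynomial in
/-- The differentiated Legendre equation. -/
theorem rodrigues_ode (l k : ℕ) (x : ℝ) :
    (x ^ 2 - 1) * (rodrigues l (k + 2)).eval x +
        2 * (k + 1 - l) * x * (rodrigues l (k + 1)).eval x =
      (k + 1) * (2 * l - k) * (rodrigues l k).eval x := by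
  have h : derivative ((X ^ 2 - 1 : ℝ[X]) ^ l) * X * X - derivative ((X ^ 2 - 1 : ℝ[X]) ^ l) =
      C (2 * (l : ℝ)) * ((X ^ 2 - 1) ^ l * X) := by
    cases l with
    | zero => simp
    | succ l =>
      rw [derivative_X_sq_sub_one_pow_succ]
      push_cast
      ring
  have h' := congrArg (fun p => (derivative^[k + 1] p).eval x) h
  simp only [iterate_derivative_sub, iterate_derivative_C_mul, iterate_derivative_mul_X,
    ← Function.iterate_succ_apply, nsmul_eq_mul, Nat.add_sub_cancel, Nat.succ_eq_add_one] at h'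
  cases k with
  | zero =>
    simp [rodrigues] at h' ⊢
    linear_combination h'
  | succ k =>
    simp [rodrigues] at h' ⊢
    linear_combination h'

open Polynomial in
theorem natDegree_X_sq_sub_one_pow (l : ℕ) : ((X ^ 2 - 1 : ℝ[X]) ^ l).natDegree = 2 * l := by
  rw [natDegree_pow, show (X ^ 2 - 1 : ℝ[X]) = X ^ 2 - C 1 by simp, natDegree_X_pow_sub_C]
  ring

theorem rodrigues_eq_zero {l k : ℕ} (h : 2 * l < k) : rodrigues l k = 0 :=
  Polynomial.iterate_derivative_eq_zero (by rwa [natDegree_X_sq_sub_one_pow])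

open Polynomial in
theorem rodrigues_two_mul (l : ℕ) : rodrigues l (2 * l) = C ((2 * l).factorial : ℝ) := by
  have hdeg : (rodrigues l (2 * l)).natDegree = 0 := by
    have := natDegree_iterate_derivative ((X ^ 2 - 1 : ℝ[X]) ^ l) (2 * l)
    rw [natDegree_X_sq_sub_one_pow, Nat.sub_self] at this
    exact Nat.le_zero.mp this
  have hmonic : ((X ^ 2 - 1 : ℝ[X]) ^ l).Monic := by
    rw [show (X ^ 2 - 1 : ℝ[X]) = X ^ 2 - C 1 by simp]
    exact (monic_X_pow_sub_C 1 two_ne_zero).pow l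
  have hcoeff : ((X ^ 2 - 1 : ℝ[X]) ^ l).coeff (2 * l) = 1 := by
    rw [← natDegree_X_sq_sub_one_pow l]
    exact hmonic
  rw [eq_C_of_natDegree_eq_zero hdeg, rodrigues, coeff_iterate_derivative, zero_add, hcoeff,
    Nat.descFactorial_self, nsmul_eq_mul, mul_one]

/-- `p_l^m` in terms of the derivatives of `(X² - 1)^l`. -/
theorem pml_eq_eval (m l : ℕ) (μ : ℝ) :
    pml m l μ = Real.sqrt ((Nat.factorial (l - m) : ℝ) / (Nat.factorial (l + m) : ℝ)) *
      ((1 / (2 ^ l * (Nat.factorial l : ℝ))) * (rodrigues l (l + m)).eval μ) := by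
  have hP : legendreP l = fun x =>
      (Polynomial.C (1 / (2 ^ l * (Nat.factorial l : ℝ))) * rodrigues l l).eval x := by
    ext x
    have h : (fun y : ℝ => (y ^ 2 - 1) ^ l) =
        fun y => ((Polynomial.X ^ 2 - 1 : Polynomial ℝ) ^ l).eval y := by
      ext y
      simp
    rw [legendreP, h, iteratedDeriv_polynomial_eval, Polynomial.eval_mul, Polynomial.eval_C]
    rfl
  rw [pml, hP, iteratedDeriv_polynomial_eval, Polynomial.iterate_derivative_C_mul]
  beta_reduce
  rw [Polynomial.eval_mul, Polynomial.eval_C, rodrigues, rodrigues, ← Function.iterate_add_apply,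
    add_comm m l]

theorem continuous_pml (m l : ℕ) : Continuous (pml m l) := by
  rw [funext (pml_eq_eval m l)]
  exact continuous_const.mul (continuous_const.mul (Polynomial.continuous _))

theorem sqrt_mul_sqrt_factorial_succ (m n : ℕ) :
    Real.sqrt (((m : ℝ) + n + 1) ^ 2 - (m : ℝ) ^ 2) *
        Real.sqrt (((n + 1).factorial : ℝ) / ((m + n + 1 + m).factorial : ℝ)) =
      (n + 1) * Real.sqrt ((n.factorial : ℝ) / ((m + n + m).factorial : ℝ)) := by
  have h₁ : (0 : ℝ) ≤ n + 1 := by positivity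
  rw [← Real.sqrt_mul (by nlinarith [(m.cast_nonneg : (0 : ℝ) ≤ m), (n.cast_nonneg : (0 : ℝ) ≤ n)]),
    ← abs_of_nonneg h₁, ← Real.sqrt_sq_eq_abs, ← Real.sqrt_mul (sq_nonneg _)]
  congr 1
  rw [show m + n + 1 + m = m + n + m + 1 by ring, Nat.factorial_succ, Nat.factorial_succ]
  push_cast
  field_simp
  ring

theorem sqrt_mul_sqrt_factorial (m n : ℕ) :
    Real.sqrt (((m : ℝ) + n + 1) ^ 2 - (m : ℝ) ^ 2) *
        Real.sqrt ((n.factorial : ℝ) / ((m + n + m).factorial : ℝ)) =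
      (2 * m + n + 1) *
        Real.sqrt (((n + 1).factorial : ℝ) / ((m + n + 1 + m).factorial : ℝ)) := by
  have h₁ : (0 : ℝ) ≤ 2 * m + n + 1 := by positivity
  rw [← Real.sqrt_mul (by nlinarith [(m.cast_nonneg : (0 : ℝ) ≤ m), (n.cast_nonneg : (0 : ℝ) ≤ n)]),
    ← abs_of_nonneg h₁, ← Real.sqrt_sq_eq_abs, ← Real.sqrt_mul (sq_nonneg _)]
  congr 1
  rw [show m + n + 1 + m = m + n + m + 1 by ring, Nat.factorial_succ, Nat.factorial_succ]
  push_cast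
  field_simp
  ring

/-- The three-term recurrence for `p_l^m` at the lowest degree `l = m`. -/
theorem pml_recurrence_self (m : ℕ) (μ : ℝ) :
    (2 * (m : ℝ) + 1) * μ * pml m m μ =
      Real.sqrt (((m : ℝ) + 1) ^ 2 - (m : ℝ) ^ 2) * pml m (m + 1) μ := by
  have hs := sqrt_mul_sqrt_factorial_succ m 0
  have hR : (rodrigues (m + 1) (m + 1 + m)).eval μ =
      2 * (m + 1) * (2 * m + 1) * μ * (rodrigues m (m + m)).eval μ := by
    cases m with
    | zero =>
      have h := congrArg (Polynomial.eval μ) (rodrigues_succ_succ 0 0)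
      simp at h ⊢
      linear_combination h
    | succ m =>
      have h := rodrigues_bonnet m (2 * m + 1) μ
      rw [rodrigues_eq_zero (by lia : 2 * m < 2 * m + 1)] at h
      rw [show m + 1 + 1 + (m + 1) = 2 * m + 1 + 2 by ring,
        show m + 1 + (m + 1) = 2 * m + 1 + 1 by ring]
      push_cast at h ⊢
      simp only [Polynomial.eval_zero] at h
      linear_combination h
  rw [pml_eq_eval, pml_eq_eval, hR, Nat.add_sub_cancel_left, Nat.sub_self]
  simp only [Nat.cast_zero, add_zero, zero_add, one_mul] at hs
  rw [← mul_assoc (Real.sqrt _) (Real.sqrt _), hs, Nat.factorial_succ m, pow_succ]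
  push_cast
  field_simp

/-- The three-term recurrence for `p_l^m` at the degree `l = m + n + 1`. -/
theorem pml_recurrence (m n : ℕ) (μ : ℝ) :
    (2 * ((m : ℝ) + n + 1) + 1) * μ * pml m (m + n + 1) μ =
      Real.sqrt (((m : ℝ) + n + 2) ^ 2 - (m : ℝ) ^ 2) * pml m (m + n + 2) μ +
        Real.sqrt (((m : ℝ) + n + 1) ^ 2 - (m : ℝ) ^ 2) * pml m (m + n) μ := by
  have hs₁ := sqrt_mul_sqrt_factorial_succ m (n + 1)
  have hs₂ := sqrt_mul_sqrt_factorial m n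
  have hR := rodrigues_bonnet (m + n) (m + n + m) μ
  rw [pml_eq_eval, pml_eq_eval, pml_eq_eval, show m + n + 1 - m = n + 1 by lia,
    show m + n + 2 - m = n + 2 by lia, Nat.add_sub_cancel_left,
    ← mul_assoc (Real.sqrt _) (Real.sqrt _), ← mul_assoc (Real.sqrt _) (Real.sqrt _), hs₂]
  rw [← add_assoc m n 1, show n + 1 + 1 = n + 2 by ring,
    show m + n + 1 + 1 = m + n + 2 by ring] at hs₁
  push_cast at hs₁ hR
  rw [show (m : ℝ) + (n + 1) + 1 = m + n + 2 by ring] at hs₁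
  rw [hs₁, show m + n + 2 + m = m + n + m + 2 by ring,
    show m + n + 1 + m = m + n + m + 1 by ring, Nat.factorial_succ (m + n + 1),
    Nat.factorial_succ (m + n), pow_add (2 : ℝ) (m + n) 2, pow_succ (2 : ℝ) (m + n)]
  push_cast
  field_simp
  linear_combination -hR

theorem intervalIntegrable_div_sub_mul {f : ℝ → ℝ} (hf : Continuous f) (m : ℕ) {ν : ℝ}
    (hν : 1 < |ν|) :
    IntervalIntegrable (fun μ => f μ / (ν - μ) * (1 - μ ^ 2) ^ m) volume (-1) 1 := by
  refine ContinuousOn.intervalIntegrable ?_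
  rw [Set.uIcc_of_le (by norm_num)]
  refine (hf.continuousOn.div (by fun_prop) fun μ hμ h => ?_).mul (by fun_prop)
  rw [sub_eq_zero.mp h] at hν
  exact absurd (abs_le.mpr hμ) hν.not_ge

theorem integral_one_sub_sq_pow_succ (m : ℕ) :
    (2 * (m : ℝ) + 3) * ∫ μ in (-1 : ℝ)..1, (1 - μ ^ 2) ^ (m + 1) =
      2 * (m + 1) * ∫ μ in (-1 : ℝ)..1, (1 - μ ^ 2) ^ m := by
  have h : ∫ μ in (-1 : ℝ)..1,
      ((2 * (m : ℝ) + 3) * (1 - μ ^ 2) ^ (m + 1) - 2 * (m + 1) * (1 - μ ^ 2) ^ m) = 0 := by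
    rw [intervalIntegral.integral_eq_sub_of_hasDerivAt
      (f := fun μ => μ * (1 - μ ^ 2) ^ (m + 1)) (fun μ _ => ?_)
      (Continuous.intervalIntegrable (by fun_prop) _ _)]
    · simp
    · have h := (hasDerivAt_id μ).mul ((((hasDerivAt_id μ).pow 2).const_sub 1).pow (m + 1))
      refine h.congr_deriv ?_
      simp
      ring
  rw [intervalIntegral.integral_sub (Continuous.intervalIntegrable (by fun_prop) _ _)
    (Continuous.intervalIntegrable (by fun_prop) _ _), intervalIntegral.integral_const_mul,
    intervalIntegral.integral_const_mul] at h
  linarith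

theorem integral_one_sub_sq_pow (m : ℕ) :
    ∫ μ in (-1 : ℝ)..1, (1 - μ ^ 2) ^ m =
      2 * 4 ^ m * (m.factorial : ℝ) ^ 2 / ((2 * m + 1).factorial : ℝ) := by
  induction m with
  | zero => norm_num
  | succ m ih =>
    have h := integral_one_sub_sq_pow_succ m
    rw [ih] at h
    refine mul_left_cancel₀ (by positivity : (2 * (m : ℝ) + 3) ≠ 0) (h.trans ?_)
    rw [show 2 * (m + 1) + 1 = 2 * m + 1 + 1 + 1 by ring, Nat.factorial_succ m,
      Nat.factorial_succ (2 * m + 1 + 1), Nat.factorial_succ (2 * m + 1)]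
    push_cast
    field_simp
    ring

/-- `p_l^m` is orthogonal to the constants for `l > m`. -/
theorem integral_pml_eq_zero {m l : ℕ} (h : m < l) :
    ∫ μ in (-1 : ℝ)..1, pml m l μ * (1 - μ ^ 2) ^ m = 0 := by
  have hR : ∫ μ in (-1 : ℝ)..1, ((l : ℝ) + m + 1) * (l - m) *
      ((rodrigues l (l + m)).eval μ * (1 - μ ^ 2) ^ m) = 0 := by
    rw [intervalIntegral.integral_eq_sub_of_hasDerivAt
      (f := fun μ => -((rodrigues l (l + m + 1)).eval μ * (1 - μ ^ 2) ^ (m + 1)))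
      (fun μ _ => ?_) (Continuous.intervalIntegrable (by fun_prop) _ _)]
    · simp
    · have h := (((rodrigues l (l + m + 1)).hasDerivAt μ).mul
        ((((hasDerivAt_id μ).pow 2).const_sub 1).pow (m + 1))).neg
      refine h.congr_deriv ?_
      have hode := rodrigues_ode l (l + m) μ
      rw [derivative_rodrigues]
      simp
      push_cast at hode
      linear_combination ((1 - μ ^ 2) ^ m) * hode
  rw [intervalIntegral.integral_const_mul] at hR
  have hc : ((l : ℝ) + m + 1) * (l - m) ≠ 0 :=
    mul_ne_zero (by positivity) (sub_ne_zero.mpr (by exact_mod_cast h.ne'))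
  simp_rw [pml_eq_eval, mul_assoc]
  rw [intervalIntegral.integral_const_mul, intervalIntegral.integral_const_mul,
    (mul_eq_zero.mp hR).resolve_left hc, mul_zero, mul_zero]

theorem pml_self (m : ℕ) (μ : ℝ) :
    pml m m μ = Real.sqrt (Nat.factorial (2 * m)) / (2 ^ m * Nat.factorial m) := by
  rw [pml_eq_eval, ← two_mul, rodrigues_two_mul, Polynomial.eval_C, Nat.sub_self,
    Nat.factorial_zero, Nat.cast_one, Real.sqrt_div zero_le_one, Real.sqrt_one]
  have h := Real.sq_sqrt (Nat.cast_nonneg (α := ℝ) (Nat.factorial (2 * m)))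
  have h' : Real.sqrt ((2 * m).factorial : ℝ) ≠ 0 :=
    (Real.sqrt_pos.mpr (by positivity)).ne'
  field_simp
  exact h.symm

theorem integral_pml_self (m : ℕ) :
    (2 * (m : ℝ) + 1) / 2 * (∫ μ in (-1 : ℝ)..1, pml m m μ * (1 - μ ^ 2) ^ m) *
      (Real.sqrt (Nat.factorial (2 * m)) / (2 ^ m * Nat.factorial m)) = 1 := by
  simp_rw [pml_self]
  rw [intervalIntegral.integral_const_mul, integral_one_sub_sq_pow, Nat.factorial_succ (2 * m)]
  have h := Real.sq_sqrt (Nat.cast_nonneg (α := ℝ) (Nat.factorial (2 * m)))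
  have h4 : (4 : ℝ) ^ m = (2 ^ m) ^ 2 := by rw [← pow_mul, mul_comm, pow_mul]; norm_num
  rw [h4]
  push_cast
  field_simp
  linear_combination h

/-- Multiplying by `ν` inside the Cauchy-type integral splits off a moment of `p_l^m`. -/
theorem mul_qml (m l : ℕ) {ν : ℝ} (hν : 1 < |ν|) :
    ν * qml m l ν = (1 / 2) * (∫ μ in (-1 : ℝ)..1, pml m l μ * (1 - μ ^ 2) ^ m) +
      (1 / 2) * ∫ μ in (-1 : ℝ)..1, μ * pml m l μ / (ν - μ) * (1 - μ ^ 2) ^ m := by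
  have hc := continuous_pml m l
  rw [qml, ← mul_add, ← intervalIntegral.integral_add
    (Continuous.intervalIntegrable (by fun_prop) _ _)
    (intervalIntegrable_div_sub_mul (by fun_prop) m hν), mul_left_comm,
    ← intervalIntegral.integral_const_mul]
  congr 1
  refine intervalIntegral.integral_congr fun μ hμ => ?_
  rw [Set.uIcc_of_le (by norm_num)] at hμ
  have h : ν - μ ≠ 0 := fun h => by
    rw [sub_eq_zero.mp h] at hν
    exact absurd (abs_le.mpr hμ) hν.not_ge
  field_simp
  ring

theorem qml_recurrence_self (m : ℕ) {ν : ℝ} (hν : 1 < |ν|) :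
    (2 * (m : ℝ) + 1) * ν * qml m m ν =
      (2 * (m : ℝ) + 1) / 2 * (∫ μ in (-1 : ℝ)..1, pml m m μ * (1 - μ ^ 2) ^ m) +
        Real.sqrt (((m : ℝ) + 1) ^ 2 - (m : ℝ) ^ 2) * qml m (m + 1) ν := by
  have h : (2 * (m : ℝ) + 1) *
        ∫ μ in (-1 : ℝ)..1, μ * pml m m μ / (ν - μ) * (1 - μ ^ 2) ^ m =
      Real.sqrt (((m : ℝ) + 1) ^ 2 - (m : ℝ) ^ 2) *
        ∫ μ in (-1 : ℝ)..1, pml m (m + 1) μ / (ν - μ) * (1 - μ ^ 2) ^ m := by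
    rw [← intervalIntegral.integral_const_mul, ← intervalIntegral.integral_const_mul]
    congr 1
    ext μ
    linear_combination ((1 - μ ^ 2) ^ m / (ν - μ)) * pml_recurrence_self m μ
  rw [mul_assoc, mul_qml m m hν, qml]
  linear_combination (1 / 2) * h

theorem qml_recurrence (m n : ℕ) {ν : ℝ} (hν : 1 < |ν|) :
    (2 * ((m : ℝ) + n + 1) + 1) * ν * qml m (m + n + 1) ν =
      Real.sqrt (((m : ℝ) + n + 2) ^ 2 - (m : ℝ) ^ 2) * qml m (m + n + 2) ν +
        Real.sqrt (((m : ℝ) + n + 1) ^ 2 - (m : ℝ) ^ 2) * qml m (m + n) ν := by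
  have h : (2 * ((m : ℝ) + n + 1) + 1) *
        ∫ μ in (-1 : ℝ)..1, μ * pml m (m + n + 1) μ / (ν - μ) * (1 - μ ^ 2) ^ m =
      Real.sqrt (((m : ℝ) + n + 2) ^ 2 - (m : ℝ) ^ 2) *
        (∫ μ in (-1 : ℝ)..1, pml m (m + n + 2) μ / (ν - μ) * (1 - μ ^ 2) ^ m) +
      Real.sqrt (((m : ℝ) + n + 1) ^ 2 - (m : ℝ) ^ 2) *
        ∫ μ in (-1 : ℝ)..1, pml m (m + n) μ / (ν - μ) * (1 - μ ^ 2) ^ m := by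
    rw [← intervalIntegral.integral_const_mul, ← intervalIntegral.integral_const_mul,
      ← intervalIntegral.integral_const_mul, ← intervalIntegral.integral_add
        ((intervalIntegrable_div_sub_mul (continuous_pml _ _) m hν).const_mul _)
        ((intervalIntegrable_div_sub_mul (continuous_pml _ _) m hν).const_mul _)]
    congr 1
    ext μ
    linear_combination ((1 - μ ^ 2) ^ m / (ν - μ)) * pml_recurrence m n μ
  rw [mul_assoc, mul_qml m _ hν, integral_pml_eq_zero (by lia), qml, qml]
  linear_combination (1 / 2) * h

theorem gml_self (ϖ : ℝ) (β : ℕ → ℝ) (L m : ℕ) (ν : ℝ) :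
    gml ϖ β L m m ν = Real.sqrt (Nat.factorial (2 * m)) / (2 ^ m * Nat.factorial m) := by
  simp [gml, chandraAux]

theorem gml_recurrence_self (ϖ : ℝ) (β : ℕ → ℝ) (L m : ℕ) (ν : ℝ) :
    ν * hcoef ϖ β L m * gml ϖ β L m m ν =
      Real.sqrt (((m : ℝ) + 1) ^ 2 - (m : ℝ) ^ 2) * gml ϖ β L m (m + 1) ν := by
  have h : Real.sqrt (((m : ℝ) + 1) ^ 2 - (m : ℝ) ^ 2) ≠ 0 :=
    (Real.sqrt_pos.mpr (by nlinarith [(m.cast_nonneg : (0 : ℝ) ≤ m)])).ne'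
  rw [gml_self, gml, if_neg (by lia), Nat.add_sub_cancel_left, chandraAux]
  field_simp

theorem gml_recurrence (ϖ : ℝ) (β : ℕ → ℝ) (L m n : ℕ) (ν : ℝ) :
    ν * hcoef ϖ β L (m + n + 1) * gml ϖ β L m (m + n + 1) ν =
      Real.sqrt (((m : ℝ) + n + 2) ^ 2 - (m : ℝ) ^ 2) * gml ϖ β L m (m + n + 2) ν +
        Real.sqrt (((m : ℝ) + n + 1) ^ 2 - (m : ℝ) ^ 2) * gml ϖ β L m (m + n) ν := by
  have h : Real.sqrt (((m : ℝ) + n + 2) ^ 2 - (m : ℝ) ^ 2) ≠ 0 :=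
    (Real.sqrt_pos.mpr (by
      nlinarith [(m.cast_nonneg : (0 : ℝ) ≤ m), (n.cast_nonneg : (0 : ℝ) ≤ n)])).ne'
  rw [gml, gml, gml, if_neg (by lia), if_neg (by lia), if_neg (by lia),
    show m + n + 1 - m = n + 1 by lia, show m + n + 2 - m = n + 2 by lia,
    Nat.add_sub_cancel_left, chandraAux.eq_3]
  push_cast
  field_simp
  ring

/-- The Christoffel–Darboux summation formula for the pair `q_l^m`, `g_l^m`. -/
theorem christoffel_darboux_qml_gml (ϖ : ℝ) (β : ℕ → ℝ) (L m n : ℕ) {ν : ℝ} (hν : 1 < |ν|) :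
    Real.sqrt (((m : ℝ) + n + 1) ^ 2 - (m : ℝ) ^ 2) *
        (qml m (m + n) ν * gml ϖ β L m (m + n + 1) ν -
          qml m (m + n + 1) ν * gml ϖ β L m (m + n) ν) =
      1 + ν * ∑ l ∈ Finset.Icc m (m + n),
        (hcoef ϖ β L l - (2 * l + 1)) * qml m l ν * gml ϖ β L m l ν := by
  induction n with
  | zero =>
    have hq := qml_recurrence_self m hν
    have hg := gml_recurrence_self ϖ β L m ν
    have h₁ := integral_pml_self m
    rw [← gml_self ϖ β L m ν] at h₁
    simp only [Nat.cast_zero, add_zero, Finset.Icc_self, Finset.sum_singleton]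
    linear_combination h₁ + gml ϖ β L m m ν * hq - qml m m ν * hg
  | succ n ih =>
    have hq := qml_recurrence m n hν
    have hg := gml_recurrence ϖ β L m n ν
    rw [← add_assoc m n 1, Finset.sum_Icc_succ_top (by lia), mul_add, ← add_assoc, ← ih]
    push_cast
    rw [show (m : ℝ) + (n + 1) + 1 = m + n + 2 by ring]
    linear_combination gml ϖ β L m (m + n + 1) ν * hq - qml m (m + n + 1) ν * hg

theorem Lam_eq_sum (ϖ : ℝ) (β : ℕ → ℝ) (L m : ℕ) {ν : ℝ} (hν : 1 < |ν|) :
    Lam ϖ β L m ν =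
      1 - ϖ * ν * ∑ l ∈ Finset.Icc m L, β l * qml m l ν * gml ϖ β L m l ν := by
  have h : ∫ μ in (-1 : ℝ)..1, gfun ϖ β L m ν μ / (ν - μ) * (1 - μ ^ 2) ^ m =
      ∑ l ∈ Finset.Icc m L, β l * gml ϖ β L m l ν *
        ∫ μ in (-1 : ℝ)..1, pml m l μ / (ν - μ) * (1 - μ ^ 2) ^ m := by
    simp_rw [← intervalIntegral.integral_const_mul]
    rw [← intervalIntegral.integral_finsetSum fun l _ =>
      (intervalIntegrable_div_sub_mul (continuous_pml m l) m hν).const_mul _]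
    congr 1
    ext μ
    rw [gfun, Finset.sum_div, Finset.sum_mul]
    exact Finset.sum_congr rfl fun l _ => by ring
  rw [Lam, h, Finset.mul_sum, Finset.mul_sum]
  congr 1
  exact Finset.sum_congr rfl fun l _ => by rw [qml]; ring

/-- Christoffel–Darboux formula for `Λ^m`. -/
theorem stmt_1 (L : ℕ) (hL : 1 ≤ L) (ϖ : ℝ) (hϖ : ϖ ∈ Set.Ioo (0 : ℝ) 1)
    (β : ℕ → ℝ) (hβ0 : β 0 = 1)
    (hβ : ∀ l : ℕ, 1 ≤ l → l ≤ L → β l ∈ Set.Ioo (0 : ℝ) (2 * (l : ℝ) + 1))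
    (m : ℕ) (hm : m ≤ L)
    (lB : ℕ) (hlB : L ≤ lB) (ν : ℝ) (hν : 1 < |ν|) :
    Lam ϖ β L m ν =
      Real.sqrt (((lB : ℝ) + 1) ^ 2 - (m : ℝ) ^ 2) *
        (qml m lB ν * gml ϖ β L m (lB + 1) ν -
          qml m (lB + 1) ν * gml ϖ β L m lB ν) := by
  obtain ⟨n, rfl⟩ := Nat.exists_eq_add_of_le (hm.trans hlB)
  push_cast
  rw [christoffel_darboux_qml_gml ϖ β L m n hν, Lam_eq_sum ϖ β L m hν]
  have hsub : Finset.Icc m L ⊆ Finset.Icc m (m + n) := Finset.Icc_subset_Icc_right hlB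
  rw [← Finset.sum_subset hsub fun l hl hl' => ?_, Finset.mul_sum, Finset.mul_sum, sub_eq_add_neg,
    ← Finset.sum_neg_distrib]
  · congr 1
    refine Finset.sum_congr rfl fun l hl => ?_
    rw [hcoef, if_pos (Finset.mem_Icc.mp hl).2]
    ring
  · rw [Finset.mem_Icc] at hl hl'
    rw [hcoef, if_neg fun h => hl' ⟨hl.1, h⟩]
    ring
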